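/- arXiv:1807.04909 — 11 statements merged into one kernel-verified Lean document; each statement's English description precedes it below -/
import Mathlib

section
/- With respect to the lexicographic monomial order on k[x,y,z] with x > y > z, the set {g₁, g₂, g₃, g₄} is a Gröbner basis of the ideal I it generates: for every nonzero f ∈ I there exists i ∈ {1,2,3,4} such that the leading monomial of gᵢ divides the leading monomial of f. -/
open MvPolynomial

/-- The leading exponent (multidegree of the leading monomial) of a multivariate
polynomial with respect to a monomial order. -/
noncomputable def leadingExp {σ : Type*} (mo : MonomialOrder σ) {R : Type*} [CommSemiring R]
    (f : MvPolynomial σ R) : σ →₀ ℕ :=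
  mo.toSyn.symm (f.support.sup mo.toSyn)

theorem leadingExp_eq_degree {σ : Type*} (mo : MonomialOrder σ) {R : Type*} [CommSemiring R]
    (f : MvPolynomial σ R) : leadingExp mo f = mo.degree f := rfl

/-- The monomial `x ^ a * y ^ b * z ^ c` has multidegree `(a, b, c)`. -/
theorem lex_degree_monomial_fin_three {k : Type*} [Field k] (a b c : ℕ) :
    MonomialOrder.lex.degree (X 0 ^ a * X 1 ^ b * X 2 ^ c : MvPolynomial (Fin 3) k) =
      Finsupp.single 0 a + Finsupp.single 1 b + Finsupp.single 2 c := by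
  classical
  have h : (X 0 ^ a * X 1 ^ b * X 2 ^ c : MvPolynomial (Fin 3) k) =
      monomial (Finsupp.single 0 a + Finsupp.single 1 b + Finsupp.single 2 c) 1 := by
    simp [X_pow_eq_monomial, monomial_mul]
  rw [h, MonomialOrder.degree_monomial]
  simp

theorem lex_lt_iff_fin_three (u v : Fin 3 →₀ ℕ) :
    MonomialOrder.lex.toSyn u < MonomialOrder.lex.toSyn v ↔
      u 0 < v 0 ∨ u 0 = v 0 ∧ (u 1 < v 1 ∨ u 1 = v 1 ∧ u 2 < v 2) := by
  rw [MonomialOrder.lex_lt_iff, Finsupp.Lex.lt_iff]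
  simp [Fin.exists_fin_succ, Fin.forall_fin_succ]
  omega

/-- Subtracting a lexicographically smaller monomial does not change the multidegree. -/
theorem lex_degree_sub_monomial {k : Type*} [Field k] {f : MvPolynomial (Fin 3) k}
    {d : Fin 3 →₀ ℕ} (hf : MonomialOrder.lex.degree f = d) (a b c : ℕ)
    (h : a < d 0 ∨ a = d 0 ∧ (b < d 1 ∨ b = d 1 ∧ c < d 2)) :
    MonomialOrder.lex.degree (f - X 0 ^ a * X 1 ^ b * X 2 ^ c) = d := by
  rw [MonomialOrder.degree_sub_of_lt, hf]
  rw [lex_degree_monomial_fin_three, hf, lex_lt_iff_fin_three]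
  simpa using h

/-- The leading monomial of a nonzero polynomial vanishing on the curve
`(t + t ^ N, t ^ 2, t ^ 3)` is divisible by one of `y ^ 3`, `x z`, `x y`, `x ^ 2`. -/
theorem lex_degree_of_aeval_curve_eq_zero {k : Type*} [Field k] {N : ℕ} (hN : 2 ≤ N)
    {f : MvPolynomial (Fin 3) k} (hf : f ≠ 0)
    (h : aeval ![(Polynomial.X + Polynomial.X ^ N : Polynomial k), Polynomial.X ^ 2,
      Polynomial.X ^ 3] f = 0) :
    3 ≤ MonomialOrder.lex.degree f 1 ∨
      1 ≤ MonomialOrder.lex.degree f 0 ∧ 1 ≤ MonomialOrder.lex.degree f 2 ∨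
      1 ≤ MonomialOrder.lex.degree f 0 ∧ 1 ≤ MonomialOrder.lex.degree f 1 ∨
      2 ≤ MonomialOrder.lex.degree f 0 := by
  by_contra hstd
  have hcoeff := congrArg
    (fun q ↦ q.coeff (MonomialOrder.lex.degree f 0 + 2 * MonomialOrder.lex.degree f 1
      + 3 * MonomialOrder.lex.degree f 2)) h
  have hlt : ∀ u ∈ f.support, u ≠ MonomialOrder.lex.degree f →
      MonomialOrder.lex.toSyn u < MonomialOrder.lex.toSyn (MonomialOrder.lex.degree f) :=
    fun u hu hne ↦ lt_of_le_of_ne (MonomialOrder.lex.le_degree hu)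
      (fun heq ↦ hne (MonomialOrder.lex.toSyn.injective heq))
  have hlc := (MonomialOrder.lex (σ := Fin 3)).coeff_degree_ne_zero_iff.2 hf
  have hmem := (MonomialOrder.lex (σ := Fin 3)).degree_mem_support hf
  generalize MonomialOrder.lex.degree f = e at *
  simp only [aeval_def, eval₂_eq', Fin.prod_univ_three, Polynomial.finsetSum_coeff,
    Polynomial.algebraMap_eq, Polynomial.coeff_C_mul, Polynomial.coeff_zero, Matrix.cons_val,
    ← pow_mul] at hcoeff
  rw [Finset.sum_eq_single_of_mem e hmem] at hcoeff
  · refine (mul_ne_zero hlc ?_) hcoeff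
    obtain h0 | ⟨h0, h1, h2⟩ : e 0 = 0 ∨ e 0 = 1 ∧ e 1 = 0 ∧ e 2 = 0 := by omega
    · simp [h0, ← pow_add, Polynomial.coeff_X_pow]
    · simp [h0, h1, h2, Polynomial.coeff_X_pow, show 1 ≠ N by omega]
  · intro u hu hne
    have hlt := (lex_lt_iff_fin_three u e).1 (hlt u hu hne)
    have h0 : u 0 = 0 := by omega
    simp only [h0, pow_zero, one_mul, ← pow_add, Polynomial.coeff_X_pow]
    rw [if_neg (by omega), mul_zero]

/-- Polynomials with leading monomials `y ^ 3`, `x z`, `x y`,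
`x ^ 2` that vanish on the curve `(t + t ^ N, t ^ 2, t ^ 3)` form a lexicographic Gröbner basis. -/
theorem exists_leadingExp_le_of_curve {k : Type*} [Field k] {N : ℕ} (hN : 2 ≤ N)
    {g₁ g₂ g₃ g₄ : MvPolynomial (Fin 3) k}
    (hd₁ : MonomialOrder.lex.degree g₁ =
      Finsupp.single 0 0 + Finsupp.single 1 3 + Finsupp.single 2 0)
    (hd₂ : MonomialOrder.lex.degree g₂ =
      Finsupp.single 0 1 + Finsupp.single 1 0 + Finsupp.single 2 1)
    (hd₃ : MonomialOrder.lex.degree g₃ =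
      Finsupp.single 0 1 + Finsupp.single 1 1 + Finsupp.single 2 0)
    (hd₄ : MonomialOrder.lex.degree g₄ =
      Finsupp.single 0 2 + Finsupp.single 1 0 + Finsupp.single 2 0)
    (hv : ∀ g ∈ ({g₁, g₂, g₃, g₄} : Set (MvPolynomial (Fin 3) k)),
      aeval ![(Polynomial.X + Polynomial.X ^ N : Polynomial k), Polynomial.X ^ 2,
        Polynomial.X ^ 3] g = 0)
    {f : MvPolynomial (Fin 3) k} (hf : f ∈ Ideal.span {g₁, g₂, g₃, g₄}) (hf0 : f ≠ 0) :
    ∃ g ∈ ({g₁, g₂, g₃, g₄} : Set (MvPolynomial (Fin 3) k)),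
      leadingExp MonomialOrder.lex g ≤ leadingExp MonomialOrder.lex f := by
  have hker : f ∈ RingHom.ker (aeval ![(Polynomial.X + Polynomial.X ^ N : Polynomial k),
      Polynomial.X ^ 2, Polynomial.X ^ 3]) :=
    Ideal.span_le.2 (fun g hg ↦ hv g hg) hf
  simp only [leadingExp_eq_degree]
  rcases lex_degree_of_aeval_curve_eq_zero hN hf0 hker with h | h | h | h
  · exact ⟨g₁, by simp, by rw [hd₁]; intro i; fin_cases i <;> simp; omega⟩
  · exact ⟨g₂, by simp, by rw [hd₂]; intro i; fin_cases i <;> simp <;> omega⟩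
  · exact ⟨g₃, by simp, by rw [hd₃]; intro i; fin_cases i <;> simp <;> omega⟩
  · exact ⟨g₄, by simp, by rw [hd₄]; intro i; fin_cases i <;> simp; omega⟩

/-- With respect to the lexicographic monomial order on `k[x,y,z]` with `x > y > z`
(variables `X 0 = x`, `X 1 = y`, `X 2 = z`), the set `{g₁, g₂, g₃, g₄}` is a Gröbner
basis of the ideal it generates: for every nonzero `f` in the ideal, the leading
monomial of some `gᵢ` divides the leading monomial of `f` (divisibility of monomials
being the pointwise order on exponents). -/
theorem stmt_0 (k : Type*) [Field k] [CharZero k] (p r : ℕ) (hr1 : 1 ≤ r) (hr3 : r ≤ 3)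
    (g₁ g₂ g₃ g₄ : MvPolynomial (Fin 3) k)
    (hg₁ : g₁ = X 1 ^ 3 - X 2 ^ 2)
    (hg₂ : g₂ = X 0 * X 2 - X 1 ^ 2 - X 1 ^ (3 - r) * X 2 ^ (r + p))
    (hg₃ : g₃ = X 0 * X 1 - X 2 - X 1 ^ (4 - r) * X 2 ^ (r + p - 1))
    (hg₄ : g₄ = X 0 ^ 2 - X 1 - X 0 * X 1 ^ (3 - r) * X 2 ^ (r + p - 1)
      - X 1 ^ ((((r : ℤ) - 2) * (3 * (r : ℤ) - 5)) / 2).toNat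
        * X 2 ^ (-(r : ℤ) ^ 2 + 4 * (r : ℤ) + (p : ℤ) - 2).toNat) :
    ∀ f ∈ Ideal.span {g₁, g₂, g₃, g₄}, f ≠ 0 →
      ∃ g ∈ ({g₁, g₂, g₃, g₄} : Set (MvPolynomial (Fin 3) k)),
        leadingExp MonomialOrder.lex g ≤ leadingExp MonomialOrder.lex f := by
  have hd₁ := lex_degree_sub_monomial (lex_degree_monomial_fin_three (k := k) 0 3 0) 0 0 2
    (by simp)
  have hd₂ := lex_degree_sub_monomial (lex_degree_sub_monomial
    (lex_degree_monomial_fin_three (k := k) 1 0 1) 0 2 0 (by simp)) 0 (3 - r) (r + p) (by simp)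
  have hd₃ := lex_degree_sub_monomial (lex_degree_sub_monomial
    (lex_degree_monomial_fin_three (k := k) 1 1 0) 0 0 1 (by simp)) 0 (4 - r) (r + p - 1) (by simp)
  have hd₄ := lex_degree_sub_monomial (lex_degree_sub_monomial (lex_degree_sub_monomial
    (lex_degree_monomial_fin_three (k := k) 2 0 0) 0 1 0 (by simp))
    1 (3 - r) (r + p - 1) (by simp)) 0 ((((r : ℤ) - 2) * (3 * (r : ℤ) - 5)) / 2).toNat
    (-(r : ℤ) ^ 2 + 4 * (r : ℤ) + (p : ℤ) - 2).toNat (by simp)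
  simp only [pow_zero, pow_one, one_mul, mul_one] at hd₁ hd₂ hd₃ hd₄
  rw [← hg₁] at hd₁
  rw [← hg₂] at hd₂
  rw [← hg₃] at hd₃
  rw [← hg₄] at hd₄
  intro f hf hf0
  refine exists_leadingExp_le_of_curve (N := 3 + r + 3 * p) (by omega) hd₁ hd₂ hd₃ hd₄ ?_ hf hf0
  have he : (-(r : ℤ) ^ 2 + 4 * (r : ℤ) + (p : ℤ) - 2).toNat =
      if r = 2 then p + 2 else p + 1 := by
    interval_cases r <;> simp <;> omega
  rw [he] at hg₄
  rintro g (rfl | rfl | rfl | rfl)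
  · simp only [hg₁, map_sub, map_pow, aeval_X, Matrix.cons_val]
    ring
  all_goals
    interval_cases r <;>
    simp [hg₂, hg₃, hg₄] <;> ring
end

section
/- The ideal I = ⟨g₁, g₂, g₃, g₄⟩ is a prime ideal of the polynomial ring k[x,y,z]. -/
open MvPolynomial

section NormalForm

variable {k R : Type*} [CommRing k] [CommRing R] [Algebra k R]

/-- If `z ^ 2 = y ^ 3`, then `k[y, z]` is spanned by `1` and `z` over `k[y]`. -/
theorem exists_aeval_add_aeval_mul_of_mem_adjoin_pair {y z u : R} (hyz : y ^ 3 = z ^ 2)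
    (hu : u ∈ Algebra.adjoin k {y, z}) :
    ∃ A B : Polynomial k, u = Polynomial.aeval y A + Polynomial.aeval y B * z := by
  induction hu using Algebra.adjoin_induction with
  | mem v hv =>
    rcases hv with rfl | rfl
    · exact ⟨Polynomial.X, 0, by simp⟩
    · exact ⟨0, 1, by simp⟩
  | algebraMap c => exact ⟨Polynomial.C c, 0, by simp⟩
  | add u v _ _ hu hv =>
    obtain ⟨A, B, rfl⟩ := hu
    obtain ⟨A', B', rfl⟩ := hv
    exact ⟨A + A', B + B', by simp only [map_add]; ring⟩
  | mul u v _ _ hu hv =>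
    obtain ⟨A, B, rfl⟩ := hu
    obtain ⟨A', B', rfl⟩ := hv
    refine ⟨A * A' + B * B' * Polynomial.X ^ 3, A * B' + B * A', ?_⟩
    simp only [map_add, map_mul, map_pow, Polynomial.aeval_X, hyz]
    ring

/-- If multiplication by `x` sends the generators of a subalgebra `k[s]` into it, then it sends
`k[s]` into `k[s] + k x`. -/
theorem exists_mul_sub_smul_mem_adjoin {s : Set R} {x u : R}
    (hx : ∀ v ∈ s, x * v ∈ Algebra.adjoin k s) (hu : u ∈ Algebra.adjoin k s) :
    ∃ c : k, x * u - c • x ∈ Algebra.adjoin k s := by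
  induction hu using Algebra.adjoin_induction with
  | mem v hv => exact ⟨0, by simpa using hx v hv⟩
  | algebraMap c => exact ⟨c, by simp [Algebra.smul_def, mul_comm]⟩
  | add u v _ _ hu hv =>
    obtain ⟨c, hc⟩ := hu
    obtain ⟨d, hd⟩ := hv
    refine ⟨c + d, ?_⟩
    convert add_mem hc hd using 1
    rw [add_smul]
    ring
  | mul u v _ hv' hu hv =>
    obtain ⟨c, hc⟩ := hu
    obtain ⟨d, hd⟩ := hv
    refine ⟨c * d, ?_⟩
    convert add_mem (mul_mem hc hv') (Subalgebra.smul_mem _ hd c) using 1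
    simp only [Algebra.smul_def, map_mul]
    ring

/-- If `x v ∈ k[s]` for every `v` in `s` and `x ^ 2 ∈ k[s]`, then `k[x, s] = k[s] + k x`. -/
theorem exists_sub_smul_mem_adjoin {s : Set R} {x u : R}
    (hx : ∀ v ∈ s, x * v ∈ Algebra.adjoin k s) (hxx : x ^ 2 ∈ Algebra.adjoin k s)
    (hu : u ∈ Algebra.adjoin k (insert x s)) :
    ∃ c : k, u - c • x ∈ Algebra.adjoin k s := by
  induction hu using Algebra.adjoin_induction with
  | mem v hv =>
    rcases hv with rfl | hv
    · exact ⟨1, by simp⟩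
    · exact ⟨0, by simpa using Algebra.subset_adjoin hv⟩
  | algebraMap c => exact ⟨0, by simp⟩
  | add u v _ _ hu hv =>
    obtain ⟨c, hc⟩ := hu
    obtain ⟨d, hd⟩ := hv
    refine ⟨c + d, ?_⟩
    convert add_mem hc hd using 1
    rw [add_smul]
    ring
  | mul u v _ _ hu hv =>
    obtain ⟨c, hc⟩ := hu
    obtain ⟨d, hd⟩ := hv
    obtain ⟨c', hc'⟩ := exists_mul_sub_smul_mem_adjoin hx hc
    obtain ⟨d', hd'⟩ := exists_mul_sub_smul_mem_adjoin hx hd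
    refine ⟨c * d' + d * c', ?_⟩
    convert add_mem (add_mem (mul_mem hc hd) (Subalgebra.smul_mem _ hxx (c * d)))
      (add_mem (Subalgebra.smul_mem _ hd' c) (Subalgebra.smul_mem _ hc' d)) using 1
    simp only [Algebra.smul_def, map_mul, map_add]
    ring

end NormalForm

/-- The monomials `t ^ (2 * i)`, `t ^ (2 * i + 3)` and the polynomial `t + t ^ m`, `2 ≤ m`, are
linearly independent. -/
theorem eq_zero_of_aeval_sq_add_eq_zero {k : Type*} [CommRing k] {A B : Polynomial k} {c : k}
    {m : ℕ} (hm : 2 ≤ m)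
    (h : Polynomial.aeval (Polynomial.X ^ 2 : Polynomial k) A
      + Polynomial.aeval (Polynomial.X ^ 2 : Polynomial k) B * Polynomial.X ^ 3
      + c • (Polynomial.X + Polynomial.X ^ m) = 0) :
    A = 0 ∧ B = 0 ∧ c = 0 := by
  have hexp (P : Polynomial k) :
      Polynomial.aeval (Polynomial.X ^ 2 : Polynomial k) P = Polynomial.expand k 2 P := by
    rw [Polynomial.expand_eq_sum, Polynomial.aeval_eq_sum_range, Polynomial.sum_over_range]
    · simp [Polynomial.smul_eq_C_mul]
    · simp
  rw [hexp, hexp] at h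
  have hc : c = 0 := by
    have := congrArg (Polynomial.coeff · 1) h
    simpa [Polynomial.coeff_expand, Polynomial.coeff_mul_X_pow', Polynomial.coeff_X_pow,
      show 1 ≠ m by omega] using this
  subst hc
  refine ⟨?_, ?_, rfl⟩
  · ext n
    have := congrArg (Polynomial.coeff · (2 * n)) h
    have hodd : ¬ (3 ≤ 2 * n ∧ 2 ∣ 2 * n - 3) := by omega
    simpa [Polynomial.coeff_expand, Polynomial.coeff_mul_X_pow', ← ite_and, hodd] using this
  · ext n
    have := congrArg (Polynomial.coeff · (2 * n + 3)) h
    simpa [Polynomial.coeff_expand, Polynomial.coeff_mul_X_pow',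
      show ¬ 2 ∣ 2 * n + 3 by omega] using this

/-- The ideal of the curve `(t + t ^ (2 * a + 3 * b), t ^ 2, t ^ 3)`. -/
theorem isPrime_span_curve {k : Type*} [CommRing k] [IsDomain k] {a b d e : ℕ}
    (hab : a + b ≠ 0) (hde : 2 * d + 3 * e = 2 * a + 3 * b + 1) :
    (Ideal.span {X 1 ^ 3 - X 2 ^ 2,
      X 0 * X 2 - X 1 ^ 2 - X 1 ^ a * X 2 ^ (b + 1),
      X 0 * X 1 - X 2 - X 1 ^ (a + 1) * X 2 ^ b,
      X 0 ^ 2 - X 1 - X 0 * X 1 ^ a * X 2 ^ b - X 1 ^ d * X 2 ^ e} :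
      Ideal (MvPolynomial (Fin 3) k)).IsPrime := by
  set I : Ideal (MvPolynomial (Fin 3) k) := Ideal.span _ with hI
  let t : Polynomial k := Polynomial.X
  let φ : MvPolynomial (Fin 3) k →ₐ[k] Polynomial k :=
    aeval ![t + t ^ (2 * a + 3 * b), t ^ 2, t ^ 3]
  have hφ : I ≤ RingHom.ker φ := by
    have hpow : (t ^ 2) ^ d * (t ^ 3) ^ e = t * (t ^ 2) ^ a * (t ^ 3) ^ b := by
      rw [← pow_mul, ← pow_mul, ← pow_add, hde]
      ring
    rw [hI, Ideal.span_le]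
    rintro f (rfl | rfl | rfl | rfl) <;> simp [φ, RingHom.mem_ker, hpow] <;> ring
  let π := Ideal.Quotient.mkₐ k I
  have hrel {f g : MvPolynomial (Fin 3) k} (h : f - g ∈ I) : π f = π g :=
    Ideal.Quotient.eq.2 h
  have h₁ : π (X 1) ^ 3 = π (X 2) ^ 2 := by
    rw [← map_pow, ← map_pow]
    exact hrel (Ideal.subset_span (by simp))
  have h₂ : π (X 0) * π (X 2) = π (X 1) ^ 2 + π (X 1) ^ a * π (X 2) ^ (b + 1) := by
    simp only [← map_pow, ← map_mul, ← map_add]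
    exact hrel (Ideal.subset_span (by simp [sub_sub]))
  have h₃ : π (X 0) * π (X 1) = π (X 2) + π (X 1) ^ (a + 1) * π (X 2) ^ b := by
    simp only [← map_pow, ← map_mul, ← map_add]
    exact hrel (Ideal.subset_span (by simp [sub_sub]))
  have h₄ : π (X 0) ^ 2
      = π (X 1) + π (X 0) * π (X 1) ^ a * π (X 2) ^ b + π (X 1) ^ d * π (X 2) ^ e := by
    simp only [← map_pow, ← map_mul, ← map_add]
    exact hrel (Ideal.subset_span (by simp [sub_sub, add_assoc]))
  let T := Algebra.adjoin k {π (X 1), π (X 2)}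
  have hy : π (X 1) ∈ T := Algebra.subset_adjoin (by simp)
  have hz : π (X 2) ∈ T := Algebra.subset_adjoin (by simp)
  have hxy : π (X 0) * π (X 1) ∈ T :=
    h₃ ▸ add_mem hz (mul_mem (pow_mem hy _) (pow_mem hz _))
  have hxz : π (X 0) * π (X 2) ∈ T :=
    h₂ ▸ add_mem (pow_mem hy _) (mul_mem (pow_mem hy _) (pow_mem hz _))
  have hxyz : π (X 0) * π (X 1) ^ a * π (X 2) ^ b ∈ T := by
    rcases a with _ | a
    · obtain ⟨b, rfl⟩ := Nat.exists_eq_succ_of_ne_zero (show b ≠ 0 by omega)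
      convert mul_mem hxz (pow_mem hz b) using 1
      rw [Nat.succ_eq_add_one]
      ring
    · convert mul_mem hxy (mul_mem (pow_mem hy a) (pow_mem hz b)) using 1
      ring
  have hxx : π (X 0) ^ 2 ∈ T :=
    h₄ ▸ add_mem (add_mem hy hxyz) (mul_mem (pow_mem hy _) (pow_mem hz _))
  have hgen (f : MvPolynomial (Fin 3) k) :
      π f ∈ Algebra.adjoin k {π (X 0), π (X 1), π (X 2)} := by
    induction f using MvPolynomial.induction_on with
    | C c => exact Subalgebra.algebraMap_mem _ c
    | add f g hf hg => exact map_add π f g ▸ add_mem hf hg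
    | mul_X f i hf =>
      rw [map_mul]
      refine mul_mem hf (Algebra.subset_adjoin ?_)
      fin_cases i <;> simp
  have hker : RingHom.ker φ ≤ I := by
    intro f hf
    obtain ⟨c, hc⟩ := exists_sub_smul_mem_adjoin (s := {π (X 1), π (X 2)})
      (by rintro v (rfl | rfl); exacts [hxy, hxz]) hxx (hgen f)
    obtain ⟨A, B, hAB⟩ := exists_aeval_add_aeval_mul_of_mem_adjoin_pair h₁ hc
    have hfI : f - (Polynomial.aeval (X 1) A + Polynomial.aeval (X 1) B * X 2 + c • X 0) ∈ I := by
      refine Ideal.Quotient.eq.1 (?_ : π _ = π _)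
      rw [map_add, map_add, map_mul, map_smul, ← Polynomial.aeval_algHom_apply,
        ← Polynomial.aeval_algHom_apply, ← hAB, sub_add_cancel]
    have hzero := hφ hfI
    rw [RingHom.mem_ker, map_sub, RingHom.mem_ker.1 hf, zero_sub, neg_eq_zero, map_add, map_add,
      map_mul, map_smul, ← Polynomial.aeval_algHom_apply, ← Polynomial.aeval_algHom_apply] at hzero
    obtain ⟨rfl, rfl, rfl⟩ := eq_zero_of_aeval_sq_add_eq_zero (A := A) (B := B) (c := c)
      (m := 2 * a + 3 * b) (by omega) (by simpa [φ, t] using hzero)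
    simpa using hfI
  rw [le_antisymm hφ hker]
  exact RingHom.ker_isPrime φ

open MvPolynomial

/-- The ideal `I = ⟨g₁, g₂, g₃, g₄⟩` is a prime ideal of `k[x,y,z]`
(variables `X 0 = x`, `X 1 = y`, `X 2 = z`). -/
theorem stmt_1 (k : Type*) [Field k] [CharZero k] (p r : ℕ) (hr1 : 1 ≤ r) (hr3 : r ≤ 3)
    (g₁ g₂ g₃ g₄ : MvPolynomial (Fin 3) k)
    (hg₁ : g₁ = X 1 ^ 3 - X 2 ^ 2)
    (hg₂ : g₂ = X 0 * X 2 - X 1 ^ 2 - X 1 ^ (3 - r) * X 2 ^ (r + p))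
    (hg₃ : g₃ = X 0 * X 1 - X 2 - X 1 ^ (4 - r) * X 2 ^ (r + p - 1))
    (hg₄ : g₄ = X 0 ^ 2 - X 1 - X 0 * X 1 ^ (3 - r) * X 2 ^ (r + p - 1)
      - X 1 ^ ((((r : ℤ) - 2) * (3 * (r : ℤ) - 5)) / 2).toNat
        * X 2 ^ (-(r : ℤ) ^ 2 + 4 * (r : ℤ) + (p : ℤ) - 2).toNat) :
    (Ideal.span {g₁, g₂, g₃, g₄}).IsPrime := by
  subst hg₁ hg₂ hg₃ hg₄
  obtain ⟨d, e, hd, he, hde⟩ : ∃ d e : ℕ,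
      (((r : ℤ) - 2) * (3 * (r : ℤ) - 5)) / 2 = d ∧
      -(r : ℤ) ^ 2 + 4 * (r : ℤ) + (p : ℤ) - 2 = e ∧
      2 * d + 3 * e = 2 * (3 - r) + 3 * (r + p - 1) + 1 := by
    interval_cases r
    · exact ⟨1, p + 1, by norm_num, by push_cast; ring, by omega⟩
    · exact ⟨0, p + 2, by norm_num, by push_cast; ring, by omega⟩
    · exact ⟨2, p + 1, by norm_num, by push_cast; ring, by omega⟩
  rw [hd, he, Int.toNat_natCast, Int.toNat_natCast, show r + p = r + p - 1 + 1 by omega,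
    show 4 - r = 3 - r + 1 by omega, Nat.add_sub_cancel]
  exact isPrime_span_curve (by omega) hde
end

section
/- The polynomial g₄ = x² − y − x·y^(3−r)·z^(r+p−1) − y^((r−2)(3r−5)/2)·z^(−r²+4r+p−2) is irreducible in the polynomial ring k[x,y,z]. -/
open MvPolynomial

/-- The first partial derivatives of an element of the square of the ideal of the origin vanish
at the origin. -/
theorem constantCoeff_pderiv_eq_zero_of_mem_sq {σ R : Type*} [CommRing R] (i : σ)
    {f : MvPolynomial σ R}
    (hf : f ∈ RingHom.ker (constantCoeff : MvPolynomial σ R →+* R) ^ 2) :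
    constantCoeff (pderiv i f) = 0 := by
  rw [pow_two] at hf
  refine Submodule.mul_induction_on hf (fun a ha b hb => ?_) (fun a b ha hb => ?_)
  · rw [RingHom.mem_ker] at ha hb
    simp [Derivation.leibniz, ha, hb]
  · simp [ha, hb]

theorem irreducible_sq_sub_sub_mul_monomial_sub_monomial (k : Type*) [Field k] {a b c d : ℕ}
    (hab : 1 ≤ a + b) (hcd : 2 ≤ c + d) :
    Irreducible (X 0 ^ 2 - X 1 - X 0 * X 1 ^ a * X 2 ^ b - X 1 ^ c * X 2 ^ d :
      MvPolynomial (Fin 3) k) := by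
  rw [← MulEquiv.irreducible_iff (finSuccEquiv k 2)]
  set u : MvPolynomial (Fin 2) k := X 0 ^ a * X 1 ^ b with hu
  set v : MvPolynomial (Fin 2) k := X 0 + X 0 ^ c * X 1 ^ d with hv
  have h1 : finSuccEquiv k 2 (X 1) = Polynomial.C (X 0) := finSuccEquiv_X_succ (j := 0)
  have h2 : finSuccEquiv k 2 (X 2) = Polynomial.C (X 1) := finSuccEquiv_X_succ (j := 1)
  have himage : finSuccEquiv k 2 (X 0 ^ 2 - X 1 - X 0 * X 1 ^ a * X 2 ^ b - X 1 ^ c * X 2 ^ d) =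
      Polynomial.C 1 * Polynomial.X ^ 2 + Polynomial.C (-u) * Polynomial.X
        + Polynomial.C (-v) := by
    simp only [map_sub, map_mul, map_pow, h1, h2, finSuccEquiv_X_zero, hu, hv, map_neg, map_add,
      map_one]
    ring
  rw [himage]
  have hdeg := Polynomial.degree_quadratic (b := -u) (c := -v)
    (one_ne_zero : (1 : MvPolynomial (Fin 2) k) ≠ 0)
  have hlead := Polynomial.leadingCoeff_quadratic (b := -u) (c := -v)
    (one_ne_zero : (1 : MvPolynomial (Fin 2) k) ≠ 0)
  have hu0 : constantCoeff u = 0 := by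
    simp only [hu, map_mul, map_pow, constantCoeff_X, ← pow_add]
    exact zero_pow (by lia)
  have hv0 : constantCoeff v = 0 := by
    simp only [hv, map_add, map_mul, map_pow, constantCoeff_X, ← pow_add, zero_add]
    exact zero_pow (by lia)
  have hv1 : constantCoeff (pderiv 0 v) = 1 := by
    rcases Nat.eq_zero_or_pos d with rfl | hd
    · simp [hv, pderiv_X, Derivation.leibniz_pow,
        zero_pow (show c - 1 ≠ 0 by lia)]
    · simp [hv, pderiv_X, Derivation.leibniz, Derivation.leibniz_pow, zero_pow hd.ne']
  refine Polynomial.irreducible_of_eisenstein_criterion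
    (P := RingHom.ker (constantCoeff : MvPolynomial (Fin 2) k →+* k))
    (RingHom.ker_isPrime _) ?_ ?_ ?_ ?_ ?_
  · rw [hlead, RingHom.mem_ker]
    simp
  · intro n hn
    rw [hdeg] at hn
    have hn2 : n < 2 := by exact_mod_cast hn
    rw [RingHom.mem_ker]
    interval_cases n
    · simp [hv0]
    · simp [hu0, Polynomial.coeff_C]
  · rw [hdeg]
    norm_num
  · intro h
    have := constantCoeff_pderiv_eq_zero_of_mem_sq 0 h
    simp [hv1] at this
  · exact (show Polynomial.Monic _ from hlead).isPrimitive

/-- The polynomial `g₄ = x² − y − x·y^(3−r)·z^(r+p−1) − y^((r−2)(3r−5)/2)·z^(−r²+4r+p−2)`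
is irreducible in `k[x,y,z]` (variables `X 0 = x`, `X 1 = y`, `X 2 = z`). -/
theorem stmt_3 (k : Type*) [Field k] [CharZero k] (p r : ℕ) (hr1 : 1 ≤ r) (hr3 : r ≤ 3)
    (g₄ : MvPolynomial (Fin 3) k)
    (hg₄ : g₄ = X 0 ^ 2 - X 1 - X 0 * X 1 ^ (3 - r) * X 2 ^ (r + p - 1)
      - X 1 ^ ((((r : ℤ) - 2) * (3 * (r : ℤ) - 5)) / 2).toNat
        * X 2 ^ (-(r : ℤ) ^ 2 + 4 * (r : ℤ) + (p : ℤ) - 2).toNat) :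
    Irreducible g₄ := by
  subst hg₄
  apply irreducible_sq_sub_sub_mul_monomial_sub_monomial
  · lia
  · interval_cases r <;> norm_num <;> lia
end

section
/- Both (g₃, g₄) and (g₄, g₃) are regular sequences in the polynomial ring k[x,y,z]. -/
open MvPolynomial

theorem isRegular_pair_of_dvd_imp {R : Type*} [CommRing R] [IsDomain R] {a b : R} (ha : a ≠ 0)
    (hab : ∀ c, a ∣ b * c → a ∣ c) (hproper : Ideal.span {a, b} ≠ ⊤) :
    RingTheory.Sequence.IsRegular R [a, b] where
  toIsWeaklyRegular := by
    rw [RingTheory.Sequence.isWeaklyRegular_cons_iff,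
      RingTheory.Sequence.isWeaklyRegular_singleton_iff]
    refine ⟨IsSMulRegular.of_ne_zero ha, ?_⟩
    refine (isSMulRegular_quotient_iff_mem_of_smul_mem _ _).mpr fun c hc ↦ ?_
    rw [← Submodule.ideal_span_singleton_smul, smul_eq_mul, Ideal.mul_top,
      Ideal.mem_span_singleton] at hc ⊢
    exact hab c hc
  top_ne_smul := by
    rw [smul_eq_mul, Ideal.mul_top, Ideal.ofList_cons, Ideal.ofList_singleton,
      ← Ideal.span_union, Set.singleton_union]
    exact hproper.symm

theorem isRegular_pair_and_swap_of_prime {R : Type*} [CommRing R] [IsDomain R] {a b : R}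
    (ha : Prime a) (hab : ¬ a ∣ b) (hproper : Ideal.span {a, b} ≠ ⊤) :
    RingTheory.Sequence.IsRegular R [a, b] ∧ RingTheory.Sequence.IsRegular R [b, a] := by
  refine ⟨isRegular_pair_of_dvd_imp ha.ne_zero
    (fun c hc ↦ (ha.dvd_or_dvd hc).resolve_left hab) hproper,
    isRegular_pair_of_dvd_imp (fun hb ↦ hab (hb ▸ dvd_zero a)) ?_ (Set.pair_comm a b ▸ hproper)⟩
  rintro c ⟨d, hd⟩
  obtain ⟨e, rfl⟩ := (ha.dvd_or_dvd (Dvd.intro c hd)).resolve_left hab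
  exact ⟨e, mul_left_cancel₀ ha.ne_zero (by rw [hd]; ring)⟩

theorem irreducible_X_mul_X_sub_X_sub {k : Type*} [Field k] (a b : ℕ) (ha : a ≠ 0) :
    Irreducible (X 0 * X 1 - X 2 - X 1 ^ a * X 2 ^ b : MvPolynomial (Fin 3) k) := by
  have hform : (X 0 * X 1 - X 2 - X 1 ^ a * X 2 ^ b : MvPolynomial (Fin 3) k) =
      X 1 * X 0 + (-X 2 - X 1 ^ a * X 2 ^ b) := by ring
  rw [hform]
  refine irreducible_mul_X_add _ _ 0 (X_ne_zero 1) (by simp [vars_X]) ?_ ?_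
  · have h1 : (X 1 : MvPolynomial (Fin 3) k) ∈ supported k {1, 2} := X_mem_supported.mpr (by simp)
    have h2 : (X 2 : MvPolynomial (Fin 3) k) ∈ supported k {1, 2} := X_mem_supported.mpr (by simp)
    intro h
    have := mem_supported.mp
      (sub_mem (neg_mem h2) (mul_mem (pow_mem h1 a) (pow_mem h2 b))) (Finset.mem_coe.mpr h)
    simp at this
  · refine (X_prime.irreducible.isRelPrime_iff_not_dvd).mpr fun h ↦ ?_
    have h' := (dvd_sub_left (dvd_mul_of_dvd_left (dvd_pow_self (X 1) ha) _)).mp h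
    rw [dvd_neg, X_dvd_X] at h'
    simp at h'

/-- Both `(g₃, g₄)` and `(g₄, g₃)` are regular sequences in the polynomial ring
`k[x,y,z]` (variables `X 0 = x`, `X 1 = y`, `X 2 = z`). -/
theorem stmt_5 (k : Type*) [Field k] [CharZero k] (p r : ℕ) (hr1 : 1 ≤ r) (hr3 : r ≤ 3)
    (g₃ g₄ : MvPolynomial (Fin 3) k)
    (hg₃ : g₃ = X 0 * X 1 - X 2 - X 1 ^ (4 - r) * X 2 ^ (r + p - 1))
    (hg₄ : g₄ = X 0 ^ 2 - X 1 - X 0 * X 1 ^ (3 - r) * X 2 ^ (r + p - 1)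
      - X 1 ^ ((((r : ℤ) - 2) * (3 * (r : ℤ) - 5)) / 2).toNat
        * X 2 ^ (-(r : ℤ) ^ 2 + 4 * (r : ℤ) + (p : ℤ) - 2).toNat) :
    RingTheory.Sequence.IsRegular (MvPolynomial (Fin 3) k) [g₃, g₄] ∧
      RingTheory.Sequence.IsRegular (MvPolynomial (Fin 3) k) [g₄, g₃] := by
  have hprime : Prime g₃ := by
    rw [hg₃]
    exact (irreducible_X_mul_X_sub_X_sub _ _ (by omega)).prime
  have hg₃0 : eval 0 g₃ = 0 := by
    rw [hg₃]
    simp [show 4 - r ≠ 0 by omega]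
  have hg₃1 : eval ![1, 0, 0] g₃ = 0 := by
    rw [hg₃]
    simp [show 4 - r ≠ 0 by omega]
  have hexp : ((((r : ℤ) - 2) * (3 * (r : ℤ) - 5)) / 2).toNat ≠ 0 ∨
      (-(r : ℤ) ^ 2 + 4 * (r : ℤ) + (p : ℤ) - 2).toNat ≠ 0 := by
    interval_cases r <;> norm_num
    lia
  have hexp' : 3 - r ≠ 0 ∨ r + p - 1 ≠ 0 := by omega
  have hg₄0 : eval 0 g₄ = 0 := by
    rw [hg₄]
    rcases hexp with h | h <;> simp [zero_pow h]
  have hg₄1 : eval ![1, 0, 0] g₄ = 1 := by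
    rw [hg₄]
    rcases hexp with h | h <;> rcases hexp' with h' | h' <;> simp [zero_pow h, zero_pow h']
  refine isRegular_pair_and_swap_of_prime hprime ?_ fun htop ↦ ?_
  · rintro ⟨q, rfl⟩
    simp [hg₃1] at hg₄1
  · have hle : Ideal.span {g₃, g₄} ≤ RingHom.ker (eval (0 : Fin 3 → k)) := by
      rw [Ideal.span_le]
      rintro f (rfl | rfl) <;> assumption
    exact RingHom.ker_ne_top _ (top_le_iff.mp (htop ▸ hle))
end

section
/- The kernel of ρ₁ equals I, i.e., ker ρ₁ = ⟨g₁, g₂, g₃, g₄⟩ as ideals of k[x,y,z]. -/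
open MvPolynomial

/-- An ideal of `k[x,y,z]` modulo which the variables are the values at `w` of three univariate
polynomials contains every relation between these polynomials, read as power series. -/
theorem ker_aeval_coe_le_of_mk_eq {k : Type*} [Field k] {σ : Type*} (u : σ → Polynomial k)
    (I : Ideal (MvPolynomial σ k)) (w : MvPolynomial σ k)
    (h : ∀ i, Ideal.Quotient.mk I (X i) = Polynomial.aeval (Ideal.Quotient.mk I w) (u i)) :
    RingHom.ker (aeval fun i => (u i : PowerSeries k)) ≤ I := by
  intro f hf
  have hcoe : (aeval fun i => (u i : PowerSeries k)) =
      (Polynomial.coeToPowerSeries.algHom k).comp (aeval u) := by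
    ext i : 1
    simp [Polynomial.coeToPowerSeries.algHom_apply]
  have hmk : (Polynomial.aeval (Ideal.Quotient.mk I w)).comp (aeval u) =
      Ideal.Quotient.mkₐ k I := by
    ext i : 1
    simp [h]
  have hzero : aeval u f = 0 := by
    rw [RingHom.mem_ker, hcoe] at hf
    simpa [Polynomial.coeToPowerSeries.algHom_apply] using hf
  rw [← Ideal.Quotient.eq_zero_iff_mem, ← Ideal.Quotient.mkₐ_eq_mk k, ← hmk]
  simp [hzero]

/-- If `w² = y` and `w y = z`, and `x` differs from `w` by the monomial `y^a z^b`, then `x`, `y`, `z`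
are parametrized by `w`, and therefore the relations of the parametrized curve lie in `I`. -/
theorem ker_aeval_le_of_mem {k : Type*} [Field k] (a b n : ℕ) (hn : n = 2 * a + 3 * b)
    (I : Ideal (MvPolynomial (Fin 3) k))
    (hy : (X 0 - X 1 ^ a * X 2 ^ b) ^ 2 - X 1 ∈ I)
    (hz : (X 0 - X 1 ^ a * X 2 ^ b) * X 1 - X 2 ∈ I) :
    RingHom.ker (aeval ![(PowerSeries.X + PowerSeries.X ^ n : PowerSeries k),
      PowerSeries.X ^ 2, PowerSeries.X ^ 3]) ≤ I := by
  have key := ker_aeval_coe_le_of_mk_eq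
    ![(Polynomial.X + Polynomial.X ^ n : Polynomial k), Polynomial.X ^ 2, Polynomial.X ^ 3] I
    (X 0 - X 1 ^ a * X 2 ^ b) ?_
  · convert key using 3
    ext i : 1
    fin_cases i <;> simp
  · rw [← Ideal.Quotient.eq_zero_iff_mem, map_sub, sub_eq_zero, map_pow] at hy
    rw [← Ideal.Quotient.eq_zero_iff_mem, map_sub, sub_eq_zero, map_mul, ← hy] at hz
    have hx : Ideal.Quotient.mk I (X 0) = Ideal.Quotient.mk I (X 0 - X 1 ^ a * X 2 ^ b) +
        Ideal.Quotient.mk I (X 1) ^ a * Ideal.Quotient.mk I (X 2) ^ b := by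
      simp
    generalize Ideal.Quotient.mk I (X 0 - X 1 ^ a * X 2 ^ b) = w at hx hy hz ⊢
    intro i
    fin_cases i
    · simp only [Fin.zero_eta, Matrix.cons_val_zero, map_add, map_pow, Polynomial.aeval_X]
      rw [hx, ← hz, ← hy, hn]
      ring
    · simp [hy]
    · simp [← hz]
      ring

/-- Let `λ = 2 + 3p + r` and let `ρ₁ : k[x,y,z] → k[[t]]` be the `k`-algebra homomorphism
with `ρ₁(x) = t + t^(1+λ)`, `ρ₁(y) = t²`, `ρ₁(z) = t³`. Then `ker ρ₁ = ⟨g₁, g₂, g₃, g₄⟩`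
(variables `X 0 = x`, `X 1 = y`, `X 2 = z`). -/
theorem stmt_6 (k : Type*) [Field k] [CharZero k] (p r : ℕ) (hr1 : 1 ≤ r) (hr3 : r ≤ 3)
    (g₁ g₂ g₃ g₄ : MvPolynomial (Fin 3) k)
    (hg₁ : g₁ = X 1 ^ 3 - X 2 ^ 2)
    (hg₂ : g₂ = X 0 * X 2 - X 1 ^ 2 - X 1 ^ (3 - r) * X 2 ^ (r + p))
    (hg₃ : g₃ = X 0 * X 1 - X 2 - X 1 ^ (4 - r) * X 2 ^ (r + p - 1))
    (hg₄ : g₄ = X 0 ^ 2 - X 1 - X 0 * X 1 ^ (3 - r) * X 2 ^ (r + p - 1)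
      - X 1 ^ ((((r : ℤ) - 2) * (3 * (r : ℤ) - 5)) / 2).toNat
        * X 2 ^ (-(r : ℤ) ^ 2 + 4 * (r : ℤ) + (p : ℤ) - 2).toNat)
    (lam : ℕ) (hlam : lam = 2 + 3 * p + r)
    (ρ₁ : MvPolynomial (Fin 3) k →ₐ[k] PowerSeries k)
    (hρ₁ : ρ₁ = aeval
      ![PowerSeries.X + PowerSeries.X ^ (1 + lam), PowerSeries.X ^ 2, PowerSeries.X ^ 3]) :
    RingHom.ker ρ₁ = Ideal.span {g₁, g₂, g₃, g₄} := by
  subst hρ₁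
  have hd : ∃ d, (((r : ℤ) - 2) * (3 * (r : ℤ) - 5) / 2).toNat = d ∧
      (r = 1 ∧ d = 1 ∨ r = 2 ∧ d = 0 ∨ r = 3 ∧ d = 2) := by
    obtain rfl | rfl | rfl : r = 1 ∨ r = 2 ∨ r = 3 := by omega
    all_goals simp
  have he : ∃ e, (-(r : ℤ) ^ 2 + 4 * (r : ℤ) + (p : ℤ) - 2).toNat = e ∧
      (r = 1 ∧ e = p + 1 ∨ r = 2 ∧ e = p + 2 ∨ r = 3 ∧ e = p + 1) := by
    obtain rfl | rfl | rfl : r = 1 ∨ r = 2 ∨ r = 3 := by omega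
    all_goals norm_num; omega
  obtain ⟨d, hd, hd'⟩ := hd
  obtain ⟨e, he, he'⟩ := he
  rw [hd, he] at hg₄
  apply le_antisymm
  · have h₂ : g₂ ∈ Ideal.span {g₁, g₂, g₃, g₄} := Ideal.subset_span (by simp)
    have h₃ : g₃ ∈ Ideal.span {g₁, g₂, g₃, g₄} := Ideal.subset_span (by simp)
    have h₄ : g₄ ∈ Ideal.span {g₁, g₂, g₃, g₄} := Ideal.subset_span (by simp)
    generalize Ideal.span {g₁, g₂, g₃, g₄} = I at h₂ h₃ h₄ ⊢
    refine ker_aeval_le_of_mem (3 - r) (r + p - 1) _ (by omega) I ?_ ?_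
    · obtain ⟨rfl, rfl, rfl⟩ | ⟨rfl, rfl, rfl⟩ | ⟨rfl, rfl, rfl⟩ :
          r = 1 ∧ d = 1 ∧ e = p + 1 ∨ r = 2 ∧ d = 0 ∧ e = p + 2 ∨ r = 3 ∧ d = 2 ∧ e = p + 1 := by
        omega
      · convert I.sub_mem h₄ (I.mul_mem_left (X 1 * X 2 ^ p) h₃) using 1
        rw [hg₃, hg₄, show 1 + p - 1 = p by omega]
        ring
      · convert I.sub_mem h₄ (I.mul_mem_left (X 2 ^ (p + 1)) h₃) using 1
        rw [hg₃, hg₄, show 2 + p - 1 = p + 1 by omega]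
        ring
      · convert I.sub_mem h₄ (I.mul_mem_left (X 2 ^ (p + 1)) h₂) using 1
        rw [hg₂, hg₄, show 3 + p - 1 = p + 2 by omega]
        ring
    · convert h₃ using 1
      rw [hg₃, show 4 - r = 3 - r + 1 by omega]
      ring
  · have hm : ((PowerSeries.X : PowerSeries k) ^ 2) ^ (3 - r) *
        (PowerSeries.X ^ 3) ^ (r + p - 1) = PowerSeries.X ^ (1 + lam) := by
      rw [← pow_mul, ← pow_mul, ← pow_add]
      congr 1
      omega
    have hde : ((PowerSeries.X : PowerSeries k) ^ 2) ^ d * (PowerSeries.X ^ 3) ^ e =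
        PowerSeries.X ^ (2 + lam) := by
      rw [← pow_mul, ← pow_mul, ← pow_add]
      congr 1
      omega
    rw [Ideal.span_le]
    rintro g (rfl | rfl | rfl | rfl) <;> rw [SetLike.mem_coe, RingHom.mem_ker]
    · simp [hg₁]
      ring
    · rw [hg₂, show r + p = r + p - 1 + 1 by omega, pow_succ _ (r + p - 1), ← mul_assoc]
      simp [hm]
      ring
    · rw [hg₃, show 4 - r = 3 - r + 1 by omega, pow_succ' _ (3 - r), mul_assoc]
      simp [hm]
      ring
    · rw [hg₄, mul_assoc]
      simp [hm, hde]
      ring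
end

section
/- If r = 1 or r = 2, then I = ⟨g₃, g₄⟩, i.e., the ideal I is already generated by g₃ and g₄. -/
open MvPolynomial

/-- Adjoining to a generating pair two elements that are combinations of it, the first one
through the second, does not change the ideal. -/
theorem Ideal.span_insert_insert_pair_eq {R : Type*} [CommRing R] {a b c d x y z : R}
    (hb : b = y * d - x * c) (ha : a = z * c - y * b) :
    Ideal.span {a, b, c, d} = Ideal.span {c, d} := by
  have hc : c ∈ Ideal.span {c, d} := Ideal.subset_span (by simp)
  have hd : d ∈ Ideal.span {c, d} := Ideal.subset_span (by simp)
  have hb' : b ∈ Ideal.span {c, d} :=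
    hb ▸ sub_mem (Ideal.mul_mem_left _ y hd) (Ideal.mul_mem_left _ x hc)
  have ha' : a ∈ Ideal.span {c, d} :=
    ha ▸ sub_mem (Ideal.mul_mem_left _ z hc) (Ideal.mul_mem_left _ y hb')
  refine le_antisymm (Ideal.span_le.2 ?_) (Ideal.span_mono (by simp [Set.insert_subset_iff]))
  simp only [Set.insert_subset_iff, Set.singleton_subset_iff, SetLike.mem_coe]
  exact ⟨ha', hb', hc, hd⟩

/-- If `r = 1` or `r = 2`, then `I = ⟨g₁, g₂, g₃, g₄⟩` is already generated by `g₃` and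
`g₄` (variables `X 0 = x`, `X 1 = y`, `X 2 = z`). -/
theorem stmt_7 (k : Type*) [Field k] [CharZero k] (p r : ℕ) (hr1 : 1 ≤ r) (hr3 : r ≤ 3)
    (g₁ g₂ g₃ g₄ : MvPolynomial (Fin 3) k)
    (hg₁ : g₁ = X 1 ^ 3 - X 2 ^ 2)
    (hg₂ : g₂ = X 0 * X 2 - X 1 ^ 2 - X 1 ^ (3 - r) * X 2 ^ (r + p))
    (hg₃ : g₃ = X 0 * X 1 - X 2 - X 1 ^ (4 - r) * X 2 ^ (r + p - 1))
    (hg₄ : g₄ = X 0 ^ 2 - X 1 - X 0 * X 1 ^ (3 - r) * X 2 ^ (r + p - 1)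
      - X 1 ^ ((((r : ℤ) - 2) * (3 * (r : ℤ) - 5)) / 2).toNat
        * X 2 ^ (-(r : ℤ) ^ 2 + 4 * (r : ℤ) + (p : ℤ) - 2).toNat)
    (hr : r = 1 ∨ r = 2) :
    Ideal.span {g₁, g₂, g₃, g₄} = Ideal.span {g₃, g₄} := by
  have h₂ : g₂ = X 1 * g₄ - X 0 * g₃ := by
    rcases hr with rfl | rfl
    · have he : (-((1 : ℕ) : ℤ) ^ 2 + 4 * ((1 : ℕ) : ℤ) + (p : ℤ) - 2).toNat = 1 + p := by
        norm_num
        omega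
      rw [hg₂, hg₃, hg₄, he]
      norm_num
      ring
    · have he : (-((2 : ℕ) : ℤ) ^ 2 + 4 * ((2 : ℕ) : ℤ) + (p : ℤ) - 2).toNat = 2 + p := by
        norm_num
        omega
      rw [hg₂, hg₃, hg₄, he]
      norm_num
      ring
  have h₁ : g₁ = X 2 * g₃ - X 1 * g₂ := by
    have hy : 4 - r = (3 - r) + 1 := by omega
    have hz : r + p = (r + p - 1) + 1 := by omega
    rw [hg₁, hg₂, hg₃, hy, hz, Nat.add_sub_cancel]
    ring
  exact Ideal.span_insert_insert_pair_eq h₂ h₁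
end

section
/- If r = 3, then I = ⟨g₂, g₃, g₄⟩, i.e., the ideal I is already generated by g₂, g₃ and g₄. -/
open MvPolynomial

/-- If `r = 3`, then `I = ⟨g₁, g₂, g₃, g₄⟩` is already generated by `g₂`, `g₃` and `g₄` (variables `X 0 = x`, `X 1 = y`, `X 2 = z`). -/
theorem stmt_8 (k : Type*) [Field k] [CharZero k] (p r : ℕ) (hr1 : 1 ≤ r) (hr3 : r ≤ 3)
    (g₁ g₂ g₃ g₄ : MvPolynomial (Fin 3) k)
    (hg₁ : g₁ = X 1 ^ 3 - X 2 ^ 2)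
    (hg₂ : g₂ = X 0 * X 2 - X 1 ^ 2 - X 1 ^ (3 - r) * X 2 ^ (r + p))
    (hg₃ : g₃ = X 0 * X 1 - X 2 - X 1 ^ (4 - r) * X 2 ^ (r + p - 1))
    (hg₄ : g₄ = X 0 ^ 2 - X 1 - X 0 * X 1 ^ (3 - r) * X 2 ^ (r + p - 1)
      - X 1 ^ ((((r : ℤ) - 2) * (3 * (r : ℤ) - 5)) / 2).toNat
        * X 2 ^ (-(r : ℤ) ^ 2 + 4 * (r : ℤ) + (p : ℤ) - 2).toNat)
    (hr : r = 3) :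
    Ideal.span {g₁, g₂, g₃, g₄} = Ideal.span {g₂, g₃, g₄} := by
  subst hr
  have e : 3 + p - 1 = p + 2 := by omega
  have syzygy : g₁ = X 2 * g₃ - X 1 * g₂ := by
    rw [hg₁, hg₂, hg₃, e]
    ring
  refine Submodule.span_insert_eq_span ?_
  rw [syzygy]
  exact sub_mem (Ideal.mul_mem_left _ _ (Ideal.subset_span (by simp)))
    (Ideal.mul_mem_left _ _ (Ideal.subset_span (by simp)))
end

section
/- The integer n+2 divides n(m+1) + λ − (n+1)·t₁ + 1, and n+2 divides nm + λ − (n+1)·t₁′. -/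
/-- Let `n` be an odd positive integer, `m = (n+1)/2`, and `λ` an integer with
`gcd(λ, m) = 1` and `λ > n(n+1)m`. Write `λ = (nm + w)(n+1) + r` with `1 ≤ r ≤ n+1`,
`w = α(n+2) + q` with `0 ≤ q < n+2`, and `w + n + 1 = α′(n+2) + q′` with
`0 ≤ q′ < n+2`. Set `t₁ = (q + (r−1)(n+1)) mod (n+2)` and
`t₁′ = (q′ + (r−1)(n+1)) mod (n+2)`. Then `n+2` divides `n(m+1) + λ − (n+1)t₁ + 1`,
and `n+2` divides `nm + λ − (n+1)t₁′`. -/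
theorem stmt_11 (n m lam w r α q α' q' t₁ t₁' : ℤ)
    (hn : 0 < n) (hodd : Odd n) (hm : 2 * m = n + 1)
    (hgcd : Int.gcd lam m = 1) (hlam : lam > n * (n + 1) * m)
    (hdecomp : lam = (n * m + w) * (n + 1) + r) (hr1 : 1 ≤ r) (hr2 : r ≤ n + 1)
    (hw : w = α * (n + 2) + q) (hq0 : 0 ≤ q) (hq1 : q < n + 2)
    (hw' : w + n + 1 = α' * (n + 2) + q') (hq0' : 0 ≤ q') (hq1' : q' < n + 2)
    (ht₁ : t₁ = (q + (r - 1) * (n + 1)) % (n + 2))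
    (ht₁' : t₁' = (q' + (r - 1) * (n + 1)) % (n + 2)) :
    (n + 2) ∣ (n * (m + 1) + lam - (n + 1) * t₁ + 1) ∧
      (n + 2) ∣ (n * m + lam - (n + 1) * t₁') := by
  have h₁ := Int.emod_add_mul_ediv (q + (r - 1) * (n + 1)) (n + 2)
  have h₂ := Int.emod_add_mul_ediv (q' + (r - 1) * (n + 1)) (n + 2)
  rw [← ht₁] at h₁
  rw [← ht₁'] at h₂
  constructor
  · refine ⟨n * m + α * (n + 1) + (n + 1) * ((q + (r - 1) * (n + 1)) / (n + 2))
      + 1 - (r - 1) * n, ?_⟩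
    linear_combination hdecomp + (n + 1) * hw - (n + 1) * h₁
  · refine ⟨n * m + α' * (n + 1) + (n + 1) * ((q' + (r - 1) * (n + 1)) / (n + 2))
      - r * n, ?_⟩
    linear_combination hdecomp + (n + 1) * hw' - (n + 1) * h₂
end

section
/- For every integer m ≥ 1 and every integer l with 0 ≤ l ≤ m, one has Σ_{k=0}^{m−l} C(m−1+k, k)·C(m−k, l) = C(2m, m+l); equivalently, the quantity ν_l = C(2m, m+l) − Σ_{k=0}^{m−l} C(m−1+k, k)·C(m−k, l) vanishes. -/
/-- A Vandermonde-type convolution along the upper index, read off from the coefficients of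
`(1 - X)⁻¹ ^ (a + 1) * (1 - X)⁻¹ ^ (b + 1) = (1 - X)⁻¹ ^ (a + b + 2)`. -/
theorem sum_antidiagonal_choose_add_mul_choose_add (a b n : ℕ) :
    ∑ p ∈ Finset.HasAntidiagonal.antidiagonal n, (a + p.1).choose a * (b + p.2).choose b =
      (a + b + 1 + n).choose (a + b + 1) := by
  have h : (PowerSeries.mk 1 : PowerSeries ℤ) ^ (a + 1) * PowerSeries.mk 1 ^ (b + 1) =
      PowerSeries.mk 1 ^ (a + b + 1 + 1) := by ring
  simp only [PowerSeries.mk_one_pow_eq_mk_choose_add] at h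
  have hn := congrArg (PowerSeries.coeff n) h
  simp only [PowerSeries.coeff_mul, PowerSeries.coeff_mk] at hn
  exact_mod_cast hn

/-- For every integer `m ≥ 1` and every `l` with `0 ≤ l ≤ m`, one has
`Σ_{k=0}^{m−l} C(m−1+k, k)·C(m−k, l) = C(2m, m+l)`; equivalently the quantity
`ν_l = C(2m, m+l) − Σ_{k=0}^{m−l} C(m−1+k, k)·C(m−k, l)` vanishes. -/
theorem stmt_12 (m l : ℕ) (hm : 1 ≤ m) (hl : l ≤ m) :
    ∑ k ∈ Finset.range (m - l + 1), Nat.choose (m - 1 + k) k * Nat.choose (m - k) l =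
      Nat.choose (2 * m) (m + l) := by
  have h := sum_antidiagonal_choose_add_mul_choose_add (m - 1) l (m - l)
  rw [Finset.Nat.sum_antidiagonal_eq_sum_range_succ_mk,
    show m - 1 + l + 1 + (m - l) = 2 * m by lia, show m - 1 + l + 1 = m + l by lia] at h
  rw [← h]
  refine Finset.sum_congr rfl fun k hk => ?_
  rw [Finset.mem_range] at hk
  rw [Nat.choose_symm_add, show l + (m - l - k) = m - k by lia]
end

section
/- For every integer m ≥ 1 and every integer l with 0 ≤ l ≤ m−1, one has Σ_{k=1}^{m−l} (−1)^(k−1)·C(m+k−1, k−1)·C(2m, m−k)·C(m−k, l) = C(2m, l) as integers; equivalently, the quantity μ_l = C(2m, l) − Σ_{k=1}^{m−l} (−1)^(k−1)·C(m+k−1, k−1)·C(2m, m−k)·C(m−k, l) vanishes. -/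
theorem Ring.choose_neg_natCast_succ (a j : ℕ) :
    Ring.choose (-((a + 1 : ℕ) : ℤ)) j = (-1) ^ j * ((a + j).choose j : ℤ) := by
  rw [Ring.choose_neg, show ((a + 1 : ℕ) : ℤ) + j - 1 = ((a + j : ℕ) : ℤ) by push_cast; ring,
    Ring.choose_natCast, Units.smul_def, Int.coe_negOnePow_natCast, smul_eq_mul]

/-- The coefficient of `x ^ n` in `(1 + x) ^ (-(a + 1)) * (1 + x) ^ (a + 1 + r) = (1 + x) ^ r`. -/
theorem Int.alternating_sum_choose_add_mul_choose (a r n : ℕ) :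
    ∑ j ∈ Finset.range (n + 1),
      (-1 : ℤ) ^ j * (a + j).choose j * (a + 1 + r).choose (n - j) = r.choose n := by
  have h := Ring.add_choose_eq n
    (Commute.all (-((a + 1 : ℕ) : ℤ)) ((a + 1 + r : ℕ) : ℤ))
  rw [show -((a + 1 : ℕ) : ℤ) + ((a + 1 + r : ℕ) : ℤ) = (r : ℤ) by push_cast; ring,
    Ring.choose_natCast, Finset.Nat.sum_antidiagonal_eq_sum_range_succ_mk] at h
  simp only [Ring.choose_neg_natCast_succ, Ring.choose_natCast] at h
  exact h.symm


/-- For every integer `m ≥ 1` and every `l` with `0 ≤ l ≤ m−1`, one has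
`Σ_{k=1}^{m−l} (−1)^(k−1)·C(m+k−1, k−1)·C(2m, m−k)·C(m−k, l) = C(2m, l)` as integers;
equivalently the quantity
`μ_l = C(2m, l) − Σ_{k=1}^{m−l} (−1)^(k−1)·C(m+k−1, k−1)·C(2m, m−k)·C(m−k, l)`
vanishes. -/
theorem stmt_13 (m l : ℕ) (hm : 1 ≤ m) (hl : l ≤ m - 1) :
    ∑ k ∈ Finset.Icc 1 (m - l), (-1 : ℤ) ^ (k - 1) * Nat.choose (m + k - 1) (k - 1) *
        Nat.choose (2 * m) (m - k) * Nat.choose (m - k) l =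
      Nat.choose (2 * m) l := by
  obtain ⟨n, rfl⟩ : ∃ n, m = l + n + 1 := ⟨m - l - 1, by omega⟩
  have h := Int.alternating_sum_choose_add_mul_choose (l + n + 1) n n
  rw [Nat.choose_self, Nat.cast_one] at h
  have hIcc : Finset.Icc 1 (l + n + 1 - l) = Finset.Ico (0 + 1) (n + 1 + 1) := by
    ext
    simp only [Finset.mem_Icc, Finset.mem_Ico]
    omega
  rw [hIcc, ← Finset.sum_Ico_add', ← Finset.range_eq_Ico]
  refine Eq.trans ?_ ((congrArg (((2 * (l + n + 1)).choose l : ℤ) * ·) h).trans (mul_one _))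
  rw [Finset.mul_sum]
  refine Finset.sum_congr rfl fun j hj => ?_
  have hjn := Finset.mem_range.mp hj
  have hc := Nat.choose_mul (n := 2 * (l + n + 1)) (k := l + n + 1 - (j + 1)) (s := l) (by omega)
  rw [show 2 * (l + n + 1) - l = l + n + 1 + 1 + n by omega,
    show l + n + 1 - (j + 1) - l = n - j by omega] at hc
  rw [mul_assoc, ← Nat.cast_mul, hc, ← add_assoc, Nat.add_sub_cancel, Nat.add_sub_cancel]
  push_cast
  ring
end

section
/- For every integer m ≥ 1 and every integer l with 0 ≤ l ≤ m−1, one has Σ_{k=1}^{m−l} (−1)^(k−1)·C(2m−l, m+k)·C(m+k−1, k−1) = 1 as integers. -/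
theorem sum_neg_one_pow_mul_choose_add_mul_choose_add (m n : ℕ) (hn : n ≠ 0) :
    ∑ j ∈ Finset.range (n + 1),
      (-1 : ℤ) ^ j * Nat.choose (m + n) (m + j) * Nat.choose (m + j) j = 0 := by
  have h : ∀ j, (-1 : ℤ) ^ j * Nat.choose (m + n) (m + j) * Nat.choose (m + j) j =
      Nat.choose (m + n) m * ((-1 : ℤ) ^ j * Nat.choose n j) := by
    intro j
    have key := Nat.choose_mul (n := m + n) (Nat.le_add_right m j)
    rw [Nat.add_sub_cancel_left, Nat.add_sub_cancel_left, Nat.choose_symm_add] at key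
    have key' : (Nat.choose (m + n) (m + j) : ℤ) * Nat.choose (m + j) j =
        Nat.choose (m + n) m * Nat.choose n j := mod_cast key
    linear_combination (-1 : ℤ) ^ j * key'
  simp_rw [h]
  rw [← Finset.mul_sum, Int.alternating_sum_range_choose_of_ne hn, mul_zero]

theorem sum_neg_one_pow_mul_choose_succ_mul_choose_add (m n : ℕ) :
    ∑ j ∈ Finset.range (n + 1),
      (-1 : ℤ) ^ j * Nat.choose (m + n + 1) (m + j + 1) * Nat.choose (m + j) j = 1 := by
  induction n with
  | zero => simp
  | succ n ih =>
    have h : ∀ j, (-1 : ℤ) ^ j * Nat.choose (m + (n + 1) + 1) (m + j + 1) *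
        Nat.choose (m + j) j =
        (-1 : ℤ) ^ j * Nat.choose (m + (n + 1)) (m + j) * Nat.choose (m + j) j +
        (-1 : ℤ) ^ j * Nat.choose (m + n + 1) (m + j + 1) * Nat.choose (m + j) j := by
      intro j
      rw [Nat.choose_succ_succ, ← add_assoc m n 1]
      push_cast
      ring
    simp_rw [h]
    rw [Finset.sum_add_distrib,
      sum_neg_one_pow_mul_choose_add_mul_choose_add m (n + 1) n.succ_ne_zero,
      Finset.sum_range_succ, ih, Nat.choose_eq_zero_of_lt (by omega)]
    simp

/-- For every integer `m ≥ 1` and every `l` with `0 ≤ l ≤ m−1`, one has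
`Σ_{k=1}^{m−l} (−1)^(k−1)·C(2m−l, m+k)·C(m+k−1, k−1) = 1` as integers. -/
theorem stmt_14 (m l : ℕ) (hm : 1 ≤ m) (hl : l ≤ m - 1) :
    ∑ k ∈ Finset.Icc 1 (m - l), (-1 : ℤ) ^ (k - 1) * Nat.choose (2 * m - l) (m + k) *
        Nat.choose (m + k - 1) (k - 1) = 1 := by
  obtain ⟨n, hn⟩ : ∃ n, m - l = n + 1 := ⟨m - l - 1, by omega⟩
  rw [hn, show 2 * m - l = m + n + 1 by omega, ← Finset.Ico_add_one_right_eq_Icc,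
    Finset.sum_Ico_eq_sum_range, Nat.add_sub_cancel]
  refine (Finset.sum_congr rfl fun j _ => ?_).trans
    (sum_neg_one_pow_mul_choose_succ_mul_choose_add m n)
  rw [show m + (1 + j) = m + j + 1 by omega, Nat.add_sub_cancel, Nat.add_sub_cancel_left]
end
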